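/- (Classification of Lagrangian submodules of (ZMod p²)³.) Let p be an odd prime. Equip (ZMod p²)³ with the bilinear form b(x,y) = x₁y₃ + x₂y₂ + x₃y₁. Define the submodules: L_{p+1} = p·(ZMod p²)³; L_p = the span of (0,0,1) and (0,p,0); and for each a ∈ {0, 1, …, p−1}, L_a = the span of (1, a, −2⁻¹·a²) and (0, p, −p·a), where 2⁻¹ is the multiplicative inverse of 2 in ZMod p². Then a ZMod p²-submodule L of (ZMod p²)³ is Lagrangian with respect to b if and only if L equals one of L₀, …, L_{p−1}, L_p, L_{p+1}; moreover these p + 2 submodules are pairwise distinct, so there are exactly p + 2 Lagrangian submodules. -/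

import Mathlib

/-- `L_{p+1} = p·(ZMod p²)³`, the submodule of all vectors `p·w`. -/
def Ltop (p : ℕ) : Submodule (ZMod (p ^ 2)) (Fin 3 → ZMod (p ^ 2)) :=
  LinearMap.range ((p : ZMod (p ^ 2)) •
    (LinearMap.id : (Fin 3 → ZMod (p ^ 2)) →ₗ[ZMod (p ^ 2)] (Fin 3 → ZMod (p ^ 2))))

/-- `L_p`, the span of `(0,0,1)` and `(0,p,0)`. -/
def Lmid (p : ℕ) : Submodule (ZMod (p ^ 2)) (Fin 3 → ZMod (p ^ 2)) :=
  Submodule.span (ZMod (p ^ 2)) {![0, 0, 1], ![0, (p : ZMod (p ^ 2)), 0]}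

/-- `L_a`, the span of `(1, a, −2⁻¹a²)` and `(0, p, −pa)`. -/
def La (p a : ℕ) : Submodule (ZMod (p ^ 2)) (Fin 3 → ZMod (p ^ 2)) :=
  Submodule.span (ZMod (p ^ 2))
    {![1, (a : ZMod (p ^ 2)), -((2 : ZMod (p ^ 2))⁻¹ * (a : ZMod (p ^ 2)) ^ 2)],
     ![0, (p : ZMod (p ^ 2)), -((p : ZMod (p ^ 2)) * (a : ZMod (p ^ 2)))]}

section Arithmetic

variable {p : ℕ}

theorem ZMod.natCast_mul_self_sq : (p : ZMod (p ^ 2)) * p = 0 := by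
  rw [← sq]
  exact_mod_cast ZMod.natCast_self (p ^ 2)

theorem ZMod.mul_eq_zero_of_dvd_of_dvd {x y : ZMod (p ^ 2)} (hx : (p : ZMod (p ^ 2)) ∣ x)
    (hy : (p : ZMod (p ^ 2)) ∣ y) : x * y = 0 := by
  obtain ⟨s, rfl⟩ := hx
  obtain ⟨t, rfl⟩ := hy
  linear_combination s * t * ZMod.natCast_mul_self_sq (p := p)

theorem ZMod.isUnit_or_natCast_dvd (hp : p.Prime) (x : ZMod (p ^ 2)) :
    IsUnit x ∨ (p : ZMod (p ^ 2)) ∣ x := by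
  have : NeZero (p ^ 2) := ⟨pow_ne_zero 2 hp.ne_zero⟩
  obtain ⟨n, rfl⟩ := ZMod.natCast_zmod_surjective x
  by_cases h : p ∣ n
  · exact Or.inr (Nat.cast_dvd_cast h)
  · refine Or.inl ((ZMod.isUnit_iff_coprime n (p ^ 2)).2 ?_)
    exact (Nat.Coprime.pow_left 2 ((Nat.Prime.coprime_iff_not_dvd hp).2 h)).symm

theorem ZMod.natCast_self_ne_zero_sq (hp : p.Prime) : (p : ZMod (p ^ 2)) ≠ 0 := by
  rw [Ne, ZMod.natCast_eq_zero_iff]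
  intro h
  have := Nat.le_of_dvd hp.pos h
  nlinarith [hp.two_le]

theorem ZMod.natCast_mul_eq_zero_iff_dvd (hp : p.Prime) {x : ZMod (p ^ 2)} :
    (p : ZMod (p ^ 2)) * x = 0 ↔ (p : ZMod (p ^ 2)) ∣ x := by
  refine ⟨fun h => ?_, fun h => ZMod.mul_eq_zero_of_dvd_of_dvd dvd_rfl h⟩
  refine (ZMod.isUnit_or_natCast_dvd hp x).resolve_left fun hx => ?_
  exact ZMod.natCast_self_ne_zero_sq hp (hx.mul_left_eq_zero.1 h)

theorem ZMod.natCast_dvd_of_mul_self_eq_zero (hp : p.Prime) {x : ZMod (p ^ 2)}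
    (h : x * x = 0) : (p : ZMod (p ^ 2)) ∣ x := by
  obtain hx | hx := ZMod.isUnit_or_natCast_dvd hp x
  · exact (hx.mul_left_eq_zero.1 h) ▸ dvd_zero _
  · exact hx

theorem ZMod.not_natCast_dvd_one_sq (hp : p.Prime) : ¬ (p : ZMod (p ^ 2)) ∣ 1 := fun h =>
  ZMod.natCast_self_ne_zero_sq hp <| by
    simpa using (ZMod.natCast_mul_eq_zero_iff_dvd hp).2 h

theorem ZMod.exists_lt_natCast_dvd_sub (hp : p.Prime) (x : ZMod (p ^ 2)) :
    ∃ a : ℕ, a < p ∧ (p : ZMod (p ^ 2)) ∣ x - (a : ZMod (p ^ 2)) := by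
  have : NeZero (p ^ 2) := ⟨pow_ne_zero 2 hp.ne_zero⟩
  obtain ⟨n, rfl⟩ := ZMod.natCast_zmod_surjective x
  refine ⟨n % p, Nat.mod_lt _ hp.pos, (n / p : ℕ), ?_⟩
  have h : ((p * (n / p) + n % p : ℕ) : ZMod (p ^ 2)) = n := by rw [Nat.div_add_mod]
  push_cast at h ⊢
  linear_combination -h

theorem ZMod.eq_of_natCast_dvd_sub {a b : ℕ} (ha : a < p) (hb : b < p)
    (h : (p : ZMod (p ^ 2)) ∣ (a : ZMod (p ^ 2)) - b) : a = b := by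
  have h' := map_dvd (ZMod.castHom (Dvd.intro_left (p ^ 1) (by ring) : p ∣ p ^ 2) (ZMod p)) h
  simp only [map_natCast, map_sub, CharP.cast_eq_zero, zero_dvd_iff, sub_eq_zero] at h'
  exact Nat.ModEq.eq_of_lt_of_lt ((ZMod.natCast_eq_natCast_iff a b p).1 h') ha hb

theorem ZMod.two_mul_inv_two_sq (hodd : Odd p) : (2 : ZMod (p ^ 2)) * 2⁻¹ = 1 := by
  have h := ZMod.coe_mul_inv_eq_one (n := p ^ 2) 2 (Nat.coprime_two_left.2 hodd.pow)
  exact_mod_cast h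

end Arithmetic

section Lagrangian

variable {p : ℕ}

/-- `L` equals its own orthogonal complement. -/
def IsLagrangian (L : Submodule (ZMod (p ^ 2)) (Fin 3 → ZMod (p ^ 2))) : Prop :=
  ∀ v, v ∈ L ↔ ∀ w ∈ L, v 0 * w 2 + v 1 * w 1 + v 2 * w 0 = 0

theorem IsLagrangian.eq_of_le {L M : Submodule (ZMod (p ^ 2)) (Fin 3 → ZMod (p ^ 2))}
    (hL : IsLagrangian L) (hM : IsLagrangian M) (h : L ≤ M) : L = M :=
  le_antisymm h fun v hv => (hL v).2 fun w hw => (hM v).1 hv w (h hw)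

theorem mem_Ltop {v : Fin 3 → ZMod (p ^ 2)} :
    v ∈ Ltop p ↔ ∀ i, (p : ZMod (p ^ 2)) ∣ v i := by
  constructor
  · rintro ⟨w, rfl⟩ i
    exact ⟨w i, by simp⟩
  · intro h
    choose w hw using h
    exact ⟨w, by ext i; simp [hw]⟩

theorem mem_Lmid {v : Fin 3 → ZMod (p ^ 2)} :
    v ∈ Lmid p ↔ v 0 = 0 ∧ (p : ZMod (p ^ 2)) ∣ v 1 := by
  rw [Lmid, Submodule.mem_span_pair]
  constructor
  · rintro ⟨s, t, rfl⟩
    simp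
  · rintro ⟨h0, t, ht⟩
    refine ⟨v 2, t, ?_⟩
    ext i
    fin_cases i
    · simp [h0]
    · simp [ht, mul_comm]
    · simp

theorem mem_La (hodd : Odd p) {a : ℕ} {v : Fin 3 → ZMod (p ^ 2)} :
    v ∈ La p a ↔ (p : ZMod (p ^ 2)) ∣ v 1 - (a : ZMod (p ^ 2)) * v 0 ∧
      v 2 = 2⁻¹ * (a : ZMod (p ^ 2)) ^ 2 * v 0 - (a : ZMod (p ^ 2)) * v 1 := by
  have h2 := ZMod.two_mul_inv_two_sq hodd
  rw [La, Submodule.mem_span_pair]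
  constructor
  · rintro ⟨s, t, rfl⟩
    refine ⟨⟨t, ?_⟩, ?_⟩
    · simp
      ring
    · simp
      linear_combination -(a ^ 2 * s : ZMod (p ^ 2)) * h2
  · rintro ⟨⟨t, ht⟩, h⟩
    refine ⟨v 0, t, ?_⟩
    ext i
    fin_cases i
    · simp
    · simp
      linear_combination -ht
    · simp
      linear_combination (a : ZMod (p ^ 2)) * ht - h - (a ^ 2 * v 0 : ZMod (p ^ 2)) * h2

theorem isLagrangian_Ltop (hp : p.Prime) : IsLagrangian (Ltop p) := by
  intro v
  constructor
  · intro hv w hw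
    rw [mem_Ltop] at hv hw
    simp only [ZMod.mul_eq_zero_of_dvd_of_dvd (hv _) (hw _), add_zero]
  · intro h
    have key (i : Fin 3) : Pi.single i (p : ZMod (p ^ 2)) ∈ Ltop p := by
      refine mem_Ltop.2 fun j => ?_
      obtain rfl | hij := eq_or_ne j i
      · simp
      · simp [hij]
    refine mem_Ltop.2 fun i => (ZMod.natCast_mul_eq_zero_iff_dvd hp).1 ?_
    rw [mul_comm]
    fin_cases i
    · simpa using h _ (key 2)
    · simpa using h _ (key 1)
    · simpa using h _ (key 0)

theorem isLagrangian_Lmid (hp : p.Prime) : IsLagrangian (Lmid p) := by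
  intro v
  constructor
  · intro hv w hw
    rw [mem_Lmid] at hv hw
    simp [hv.1, hw.1, ZMod.mul_eq_zero_of_dvd_of_dvd hv.2 hw.2]
  · intro h
    refine mem_Lmid.2 ⟨?_, (ZMod.natCast_mul_eq_zero_iff_dvd hp).1 ?_⟩
    · simpa using h ![0, 0, 1] (by simp [mem_Lmid])
    · simpa [mul_comm] using h ![0, p, 0] (by simp [mem_Lmid])

theorem isLagrangian_La (hp : p.Prime) (hodd : Odd p) (a : ℕ) : IsLagrangian (La p a) := by
  have h2 := ZMod.two_mul_inv_two_sq hodd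
  intro v
  constructor
  · intro hv w hw
    rw [mem_La hodd] at hv hw
    linear_combination ZMod.mul_eq_zero_of_dvd_of_dvd hv.1 hw.1 + v 0 * hw.2 + w 0 * hv.2 +
      (a ^ 2 * v 0 * w 0 : ZMod (p ^ 2)) * h2
  · intro h
    have h₁ := h _ (Submodule.subset_span (Set.mem_insert _ _))
    have h₂ := h _ (Submodule.subset_span (Set.mem_insert_of_mem _ (Set.mem_singleton _)))
    simp at h₁ h₂
    refine (mem_La hodd).2 ⟨(ZMod.natCast_mul_eq_zero_iff_dvd hp).1 ?_, ?_⟩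
    · linear_combination h₂
    · linear_combination h₁

/-- A Lagrangian submodule containing a vector with unit first coordinate is some `La p a`. -/
theorem IsLagrangian.exists_eq_La (hp : p.Prime) (hodd : Odd p)
    {L : Submodule (ZMod (p ^ 2)) (Fin 3 → ZMod (p ^ 2))} (hL : IsLagrangian L)
    {v : Fin 3 → ZMod (p ^ 2)} (hv : v ∈ L) (hv0 : IsUnit (v 0)) : ∃ a < p, L = La p a := by
  have h2 := ZMod.two_mul_inv_two_sq hodd
  obtain ⟨r, hr⟩ := hv0.exists_left_inv
  have hu : r • v ∈ L := L.smul_mem r hv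
  have hu0 : (r • v) 0 = 1 := by simpa using hr
  generalize r • v = u at hu hu0
  obtain ⟨a, ha, t, ht⟩ := ZMod.exists_lt_natCast_dvd_sub hp (u 1)
  refine ⟨a, ha, hL.eq_of_le (isLagrangian_La hp hodd a) fun w hw => ?_⟩
  have huu := (hL u).1 hu u hu
  have huw := (hL u).1 hu w hw
  have hww := (hL w).1 hw w hw
  rw [hu0] at huu huw
  have hu2 : u 2 = -(2⁻¹ * u 1 ^ 2) := by linear_combination 2⁻¹ * huu - u 2 * h2
  have hw2 : w 2 = 2⁻¹ * u 1 ^ 2 * w 0 - u 1 * w 1 := by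
    linear_combination huw - w 0 * hu2
  have hdvd : (p : ZMod (p ^ 2)) ∣ w 1 - u 1 * w 0 := by
    refine ZMod.natCast_dvd_of_mul_self_eq_zero hp ?_
    linear_combination hww - 2 * w 0 * hw2 - (u 1 ^ 2 * w 0 ^ 2) * h2
  obtain ⟨s, hs⟩ := hdvd
  have hpp := ZMod.natCast_mul_self_sq (p := p)
  have hu1 : u 1 = a + p * t := by linear_combination ht
  refine (mem_La hodd).2 ⟨⟨s + t * w 0, ?_⟩, ?_⟩
  · linear_combination hs + w 0 * hu1
  · have hw1 : w 1 = u 1 * w 0 + p * s := by linear_combination hs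
    rw [hw2, hw1, hu1]
    linear_combination (2⁻¹ * t ^ 2 * w 0 - t ^ 2 * w 0 - t * s) * hpp +
      (a * p * t * w 0 : ZMod (p ^ 2)) * h2

/-- In a Lagrangian submodule, `p` divides the second coordinate if it divides the first. -/
theorem IsLagrangian.natCast_dvd_apply_one (hp : p.Prime)
    {L : Submodule (ZMod (p ^ 2)) (Fin 3 → ZMod (p ^ 2))} (hL : IsLagrangian L)
    {w : Fin 3 → ZMod (p ^ 2)} (hw : w ∈ L) (h0 : (p : ZMod (p ^ 2)) ∣ w 0) :
    (p : ZMod (p ^ 2)) ∣ w 1 := by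
  refine (ZMod.isUnit_or_natCast_dvd hp _).resolve_left fun hu => ?_
  have hww := (hL w).1 hw w hw
  have hdvd : (p : ZMod (p ^ 2)) ∣ w 1 * w 1 := by
    have : w 1 * w 1 = w 0 * (-2 * w 2) := by linear_combination hww
    exact this ▸ h0.mul_right _
  exact ZMod.not_natCast_dvd_one_sq hp (hdvd.trans (hu.mul hu).dvd)

theorem IsLagrangian.eq_Lmid (hp : p.Prime) (hodd : Odd p)
    {L : Submodule (ZMod (p ^ 2)) (Fin 3 → ZMod (p ^ 2))} (hL : IsLagrangian L)
    (h0 : ∀ v ∈ L, (p : ZMod (p ^ 2)) ∣ v 0) {v : Fin 3 → ZMod (p ^ 2)} (hv : v ∈ L)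
    (hv2 : IsUnit (v 2)) : L = Lmid p := by
  have h1 (w) (hw : w ∈ L) := hL.natCast_dvd_apply_one hp hw (h0 w hw)
  refine hL.eq_of_le (isLagrangian_Lmid hp) fun w hw => mem_Lmid.2 ⟨?_, h1 w hw⟩
  have hvw := (hL v).1 hv w hw
  rw [ZMod.mul_eq_zero_of_dvd_of_dvd (h1 v hv) (h1 w hw), add_zero] at hvw
  have hvv := (hL v).1 hv v hv
  rw [ZMod.mul_eq_zero_of_dvd_of_dvd (h1 v hv) (h1 v hv), add_zero] at hvv
  have hv0 : v 0 = 0 := by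
    refine hv2.mul_left_eq_zero.1 ?_
    linear_combination 2⁻¹ * hvv - v 0 * v 2 * ZMod.two_mul_inv_two_sq hodd
  refine hv2.mul_right_eq_zero.1 ?_
  linear_combination hvw - w 2 * hv0

theorem isLagrangian_iff (hp : p.Prime) (hodd : Odd p)
    {L : Submodule (ZMod (p ^ 2)) (Fin 3 → ZMod (p ^ 2))} :
    IsLagrangian L ↔ L = Ltop p ∨ L = Lmid p ∨ ∃ a < p, L = La p a := by
  constructor
  · intro hL
    by_cases h0 : ∀ v ∈ L, (p : ZMod (p ^ 2)) ∣ v 0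
    · by_cases h2 : ∀ v ∈ L, (p : ZMod (p ^ 2)) ∣ v 2
      · refine Or.inl (hL.eq_of_le (isLagrangian_Ltop hp) fun v hv => mem_Ltop.2 fun i => ?_)
        fin_cases i
        exacts [h0 v hv, hL.natCast_dvd_apply_one hp hv (h0 v hv), h2 v hv]
      · push Not at h2
        obtain ⟨v, hv, hv2⟩ := h2
        exact Or.inr <| Or.inl <| hL.eq_Lmid hp hodd h0 hv <|
          (ZMod.isUnit_or_natCast_dvd hp _).resolve_right hv2
    · push Not at h0
      obtain ⟨v, hv, hv0⟩ := h0
      exact Or.inr <| Or.inr <| hL.exists_eq_La hp hodd hv <|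
        (ZMod.isUnit_or_natCast_dvd hp _).resolve_right hv0
  · rintro (rfl | rfl | ⟨a, -, rfl⟩)
    exacts [isLagrangian_Ltop hp, isLagrangian_Lmid hp, isLagrangian_La hp hodd a]

theorem eq_of_La_eq (hodd : Odd p) {a b : ℕ} (ha : a < p) (hb : b < p)
    (h : La p a = La p b) : a = b := by
  have hm := (mem_La hodd).1 (h.le <| Submodule.subset_span (Set.mem_insert _ _))
  exact ZMod.eq_of_natCast_dvd_sub ha hb (by simpa using hm.1)

theorem La_ne_Lmid (hp : p.Prime) (a : ℕ) : La p a ≠ Lmid p := by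
  intro h
  have hm := mem_Lmid.1 (h.le <| Submodule.subset_span (Set.mem_insert _ _))
  exact ZMod.not_natCast_dvd_one_sq hp (by simp [show (1 : ZMod (p ^ 2)) = 0 from hm.1])

theorem La_ne_Ltop (hp : p.Prime) (a : ℕ) : La p a ≠ Ltop p := by
  intro h
  have hm := mem_Ltop.1 (h.le <| Submodule.subset_span (Set.mem_insert _ _)) 0
  exact ZMod.not_natCast_dvd_one_sq hp (by simpa using hm)

theorem Lmid_ne_Ltop (hp : p.Prime) : Lmid p ≠ Ltop p := by
  intro h
  have hm := mem_Ltop.1 (h.le <| Submodule.subset_span (Set.mem_insert _ _)) 2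
  exact ZMod.not_natCast_dvd_one_sq hp (by simpa using hm)

theorem card_isLagrangian (hp : p.Prime) (hodd : Odd p) :
    Nat.card {L : Submodule (ZMod (p ^ 2)) (Fin 3 → ZMod (p ^ 2)) // IsLagrangian L} = p + 2 := by
  let f : Option (Option (Fin p)) →
      {L : Submodule (ZMod (p ^ 2)) (Fin 3 → ZMod (p ^ 2)) // IsLagrangian L}
    | none => ⟨Ltop p, isLagrangian_Ltop hp⟩
    | some none => ⟨Lmid p, isLagrangian_Lmid hp⟩
    | some (some a) => ⟨La p a, isLagrangian_La hp hodd a⟩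
  have hf : Function.Bijective f := by
    constructor
    · rintro (_ | _ | a) (_ | _ | b) h <;> have h := congrArg Subtype.val h
      · rfl
      · exact absurd h.symm (Lmid_ne_Ltop hp)
      · exact absurd h.symm (La_ne_Ltop hp b)
      · exact absurd h (Lmid_ne_Ltop hp)
      · rfl
      · exact absurd h.symm (La_ne_Lmid hp b)
      · exact absurd h (La_ne_Ltop hp a)
      · exact absurd h (La_ne_Lmid hp a)
      · rw [Fin.ext (eq_of_La_eq hodd a.2 b.2 h)]
    · rintro ⟨L, hL⟩
      obtain h | h | ⟨a, ha, h⟩ := (isLagrangian_iff hp hodd).1 hL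
      exacts [⟨none, Subtype.ext h.symm⟩, ⟨some none, Subtype.ext h.symm⟩,
        ⟨some (some ⟨a, ha⟩), Subtype.ext h.symm⟩]
  rw [← Nat.card_congr (Equiv.ofBijective f hf)]
  simp

end Lagrangian

/-- Classification of Lagrangian submodules of `(ZMod p²)³` with respect to
`b(x,y) = x₁y₃ + x₂y₂ + x₃y₁`: they are exactly `L₀, …, L_{p−1}, L_p, L_{p+1}`; these
are pairwise distinct, so there are exactly `p + 2` Lagrangian submodules. -/
theorem lagrangian_classification_rank3 (p : ℕ) (hp : p.Prime) (hodd : Odd p) :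
    (∀ L : Submodule (ZMod (p ^ 2)) (Fin 3 → ZMod (p ^ 2)),
      (∀ v, v ∈ L ↔ ∀ w ∈ L, v 0 * w 2 + v 1 * w 1 + v 2 * w 0 = 0) ↔
        (L = Ltop p ∨ L = Lmid p ∨ ∃ a < p, L = La p a)) ∧
    (∀ a < p, ∀ a' < p, La p a = La p a' → a = a') ∧
    (∀ a < p, La p a ≠ Lmid p ∧ La p a ≠ Ltop p) ∧
    Lmid p ≠ Ltop p ∧
    Nat.card {L : Submodule (ZMod (p ^ 2)) (Fin 3 → ZMod (p ^ 2)) //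
      ∀ v, v ∈ L ↔ ∀ w ∈ L, v 0 * w 2 + v 1 * w 1 + v 2 * w 0 = 0} = p + 2 := by
  exact ⟨fun _ => isLagrangian_iff hp hodd, fun _ ha _ hb => eq_of_La_eq hodd ha hb,
    fun a _ => ⟨La_ne_Lmid hp a, La_ne_Ltop hp a⟩, Lmid_ne_Ltop hp, card_isLagrangian hp hodd⟩
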